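/- arXiv:1208.6286 — 2 statements merged into one kernel-verified Lean document; each statement's English description precedes it below -/
import Mathlib

section
/- For every c = (c_0, …, c_n) and every m_1, …, m_n ∈ ℂ, the functional J is convex on the convex set 𝔓°_+(N) × 𝔓_+(N); equivalently, its second directional derivative at any (P,Q) ∈ 𝔓°_+(N) × 𝔓_+(N) in any direction (δP, δQ) equals (1/(2N)) Σ_{j=-N+1}^{N} (δP(ζ_j) − P(ζ_j)·Q(ζ_j)^{-1}·δQ(ζ_j))² / P(ζ_j), which is nonnegative. -/
open Complex Finset Filter Topology

noncomputable section

/-- Coefficient space for symmetric trigonometric polynomials of degree `n`: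
`(p₀, (p₁, …, pₙ))` with `p₀` real and `p₋ₖ = conj pₖ` implicit. Also used for
covariance data `c = (c₀, (c₁, …, cₙ))`. -/
abbrev Coef (n : ℕ) := ℝ × (Fin n → ℂ)

/-- The `2N`-th roots of unity `ζ_j = exp(iπj/N)`. -/
def zet (N : ℕ) (j : ℤ) : ℂ := Complex.exp (Real.pi * Complex.I * j / N)

/-- The index set `j = -N+1, …, N`. -/
def idxs (N : ℕ) : Finset ℤ := Finset.Icc (-(N : ℤ) + 1) N

/-- Evaluation of `P(z) = Σ_{k=-n}^n p_k z^{-k}` (with `p₋ₖ = conj pₖ`). -/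
def evalC {n : ℕ} (p : Coef n) (z : ℂ) : ℂ :=
  (p.1 : ℂ) + ∑ k : Fin n,
    (p.2 k * z⁻¹ ^ ((k : ℕ) + 1) + (starRingEnd ℂ) (p.2 k) * z ^ ((k : ℕ) + 1))

/-- Real value of the symmetric trigonometric polynomial on the unit circle. -/
def evalR {n : ℕ} (p : Coef n) (z : ℂ) : ℝ := (evalC p z).re

/-- The open cone `𝔓₊(N)`. -/
def Pplus (n N : ℕ) : Set (Coef n) := {p | ∀ j ∈ idxs N, 0 < evalR p (zet N j)}

/-- The closure of `𝔓₊(N)`: `P(ζ_j) ≥ 0` for all `j`. -/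
def Pnn (n N : ℕ) : Set (Coef n) := {p | ∀ j ∈ idxs N, 0 ≤ evalR p (zet N j)}

/-- The cone `𝔓₊` of trigonometric polynomials positive on the whole circle. -/
def PplusC (n : ℕ) : Set (Coef n) :=
  {p | ∀ θ ∈ Set.Icc (-Real.pi) Real.pi, 0 < evalR p (Complex.exp (θ * Complex.I))}

/-- The closure of `𝔓₊`: nonnegative on the whole circle. -/
def PnnC (n : ℕ) : Set (Coef n) :=
  {p | ∀ θ ∈ Set.Icc (-Real.pi) Real.pi, 0 ≤ evalR p (Complex.exp (θ * Complex.I))}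

/-- The pairing `⟨C,P⟩ = Σ_{k=-n}^n c_k conj(p_k)` (a real number). -/
def pairCP {n : ℕ} (c p : Coef n) : ℝ :=
  c.1 * p.1 + ∑ k : Fin n, 2 * (c.2 k * (starRingEnd ℂ) (p.2 k)).re

/-- The open dual cone `ℭ₊(N)`. -/
def Cplus (n N : ℕ) : Set (Coef n) := {c | ∀ p ∈ Pnn n N, p ≠ 0 → 0 < pairCP c p}

/-- The open dual cone `ℭ₊`. -/
def CplusC (n : ℕ) : Set (Coef n) := {c | ∀ p ∈ PnnC n, p ≠ 0 → 0 < pairCP c p}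

/-- The discrete moment `(1/(2N)) Σ_j ζ_j^k Φ(ζ_j)`. -/
def dmom (N : ℕ) (Φ : ℤ → ℝ) (k : ℤ) : ℂ :=
  (1 / (2 * (N : ℂ))) * ∑ j ∈ idxs N, zet N j ^ k * (Φ j : ℂ)

/-- `Φ` (a function of the index `j`) satisfies the moment conditions for `c`. -/
def MomCond {n : ℕ} (N : ℕ) (c : Coef n) (Φ : ℤ → ℝ) : Prop :=
  dmom N Φ 0 = (c.1 : ℂ) ∧ ∀ k : Fin n, dmom N Φ ((k : ℕ) + 1) = c.2 k

/-- The function `j ↦ P(ζ_j)/Q(ζ_j)`. -/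
def phiOf {n : ℕ} (N : ℕ) (P Q : Coef n) : ℤ → ℝ :=
  fun j => evalR P (zet N j) / evalR Q (zet N j)

/-- The dual functional `J_P(Q) = ⟨C,Q⟩ − (1/(2N)) Σ_j P(ζ_j) log Q(ζ_j)`. -/
def JP {n : ℕ} (N : ℕ) (c P Q : Coef n) : ℝ :=
  pairCP c Q - (1 / (2 * (N : ℝ))) * ∑ j ∈ idxs N,
    evalR P (zet N j) * Real.log (evalR Q (zet N j))

/-- The moment map `F^P`, with components `F^P_k(Q) = (1/(2N)) Σ_j ζ_j^k P(ζ_j)/Q(ζ_j)`. -/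
def Fmap {n : ℕ} (N : ℕ) (P Q : Coef n) : Coef n :=
  ((dmom N (phiOf N P Q) 0).re, fun k => dmom N (phiOf N P Q) ((k : ℕ) + 1))

/-- The real-valued functional
`J(P,Q) = ⟨C,Q⟩ − ⟨M,P⟩ + (1/(2N)) Σ_j P(ζ_j) log(P(ζ_j)/Q(ζ_j))` on the open domain. -/
def Jfun {n : ℕ} (N : ℕ) (c : Coef n) (m : Fin n → ℂ) (P Q : Coef n) : ℝ :=
  pairCP c Q - pairCP ((0 : ℝ), m) P + (1 / (2 * (N : ℝ))) *
    ∑ j ∈ idxs N, evalR P (zet N j) * Real.log (evalR P (zet N j) / evalR Q (zet N j))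

/-- The open domain `𝔓°₊(N) × 𝔓₊(N)`. -/
def DomOp (n N : ℕ) : Set (Coef n × Coef n) :=
  {PQ | PQ.1 ∈ Pplus n N ∧ PQ.1.1 = 1 ∧ PQ.2 ∈ Pplus n N}

theorem evalR_add {n : ℕ} (p q : Coef n) (z : ℂ) :
    evalR (p + q) z = evalR p z + evalR q z := by
  simp only [evalR, ← Complex.add_re]
  congr 1
  simp only [evalC, Prod.fst_add, Prod.snd_add, Pi.add_apply, map_add, Complex.ofReal_add]
  rw [add_add_add_comm, ← Finset.sum_add_distrib]
  congr 1
  exact Finset.sum_congr rfl fun k _ => by ring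

theorem evalR_smul {n : ℕ} (t : ℝ) (p : Coef n) (z : ℂ) :
    evalR (t • p) z = t * evalR p z := by
  rw [evalR, evalR, ← Complex.re_ofReal_mul]
  congr 1
  simp only [evalC, Prod.smul_fst, Prod.smul_snd, Pi.smul_apply, smul_eq_mul, Complex.real_smul,
    map_mul, Complex.conj_ofReal, Complex.ofReal_mul]
  rw [mul_add, Finset.mul_sum]
  congr 1
  exact Finset.sum_congr rfl fun k _ => by ring

theorem pairCP_add {n : ℕ} (c p q : Coef n) :
    pairCP c (p + q) = pairCP c p + pairCP c q := by
  simp only [pairCP, Prod.fst_add, Prod.snd_add, Pi.add_apply, map_add, mul_add, Complex.add_re,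
    Finset.sum_add_distrib]
  ring

theorem pairCP_smul {n : ℕ} (t : ℝ) (c p : Coef n) :
    pairCP c (t • p) = t * pairCP c p := by
  simp only [pairCP, Prod.smul_fst, Prod.smul_snd, Pi.smul_apply, smul_eq_mul, Complex.real_smul,
    map_mul, Complex.conj_ofReal, mul_add, Finset.mul_sum]
  congr 1
  · ring
  · refine Finset.sum_congr rfl fun k _ => ?_
    rw [mul_left_comm (c.2 k), Complex.re_ofReal_mul]
    ring

/-- Joint convexity of the relative entropy `p * log (p / q)`. -/
theorem mul_log_div_le {p₁ q₁ p₂ q₂ a b : ℝ} (hp₁ : 0 < p₁) (hq₁ : 0 < q₁) (hp₂ : 0 < p₂)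
    (hq₂ : 0 < q₂) (ha : 0 ≤ a) (hb : 0 ≤ b) (hab : a + b = 1) :
    (a * p₁ + b * p₂) * Real.log ((a * p₁ + b * p₂) / (a * q₁ + b * q₂)) ≤
      a * (p₁ * Real.log (p₁ / q₁)) + b * (p₂ * Real.log (p₂ / q₂)) := by
  have hq : 0 < a * q₁ + b * q₂ := by
    rcases ha.eq_or_lt with rfl | ha'
    · obtain rfl : b = 1 := by linarith
      simpa using hq₂
    · positivity
  set q := a * q₁ + b * q₂ with hqdef
  have key := Real.convexOn_mul_log.2
    (Set.mem_Ici.2 (div_pos hp₁ hq₁).le) (Set.mem_Ici.2 (div_pos hp₂ hq₂).le)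
    (show 0 ≤ a * q₁ / q by positivity) (show 0 ≤ b * q₂ / q by positivity)
    (by rw [← add_div, ← hqdef, div_self hq.ne'])
  simp only [smul_eq_mul] at key
  have hx : a * q₁ / q * (p₁ / q₁) + b * q₂ / q * (p₂ / q₂) = (a * p₁ + b * p₂) / q := by
    field_simp
  rw [hx] at key
  calc (a * p₁ + b * p₂) * Real.log ((a * p₁ + b * p₂) / q)
      = q * ((a * p₁ + b * p₂) / q * Real.log ((a * p₁ + b * p₂) / q)) := by
        rw [← mul_assoc, mul_div_cancel₀ _ hq.ne']
    _ ≤ _ := mul_le_mul_of_nonneg_left key hq.le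
    _ = a * (p₁ * Real.log (p₁ / q₁)) + b * (p₂ * Real.log (p₂ / q₂)) := by
        field_simp

theorem hasDerivAt_mul_log_div {a x b y t : ℝ} (ha : 0 < a + t * x) (hb : 0 < b + t * y) :
    HasDerivAt (fun s : ℝ => (a + s * x) * Real.log ((a + s * x) / (b + s * y)))
      (x * Real.log ((a + t * x) / (b + t * y)) + x - (a + t * x) / (b + t * y) * y) t := by
  have h₁ : HasDerivAt (fun s : ℝ => a + s * x) x t := by
    simpa using ((hasDerivAt_id t).mul_const x).const_add a
  have h₂ : HasDerivAt (fun s : ℝ => b + s * y) y t := by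
    simpa using ((hasDerivAt_id t).mul_const y).const_add b
  refine (h₁.mul ((h₁.div h₂ hb.ne').log (div_pos ha hb).ne')).congr_deriv ?_
  simp only [Pi.div_apply]
  generalize a + t * x = u at ha ⊢
  generalize b + t * y = v at hb ⊢
  field_simp
  ring

theorem hasDerivAt_log_div_sub_div {a x b y : ℝ} (ha : 0 < a) (hb : 0 < b) :
    HasDerivAt (fun t : ℝ =>
        x * Real.log ((a + t * x) / (b + t * y)) + x - (a + t * x) / (b + t * y) * y)
      ((x - a / b * y) ^ 2 / a) 0 := by
  have h₁ : HasDerivAt (fun s : ℝ => a + s * x) x 0 := by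
    simpa using ((hasDerivAt_id (0 : ℝ)).mul_const x).const_add a
  have h₂ : HasDerivAt (fun s : ℝ => b + s * y) y 0 := by
    simpa using ((hasDerivAt_id (0 : ℝ)).mul_const y).const_add b
  have h₃ := h₁.div h₂ (by simpa using hb.ne')
  have h₄ := h₃.log (by simpa using (div_pos ha hb).ne')
  refine (((h₄.const_mul x).add_const x).sub (h₃.mul_const y)).congr_deriv ?_
  simp only [Pi.div_apply, zero_mul, add_zero]
  field_simp

theorem convex_DomOp (n N : ℕ) : Convex ℝ (DomOp n N) := by
  have hP : Convex ℝ (Pplus n N) := by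
    intro p hp q hq a b ha hb hab j hj
    rw [evalR_add, evalR_smul, evalR_smul]
    exact convex_Ioi (0 : ℝ) (hp j hj) (hq j hj) ha hb hab
  rintro ⟨P₁, Q₁⟩ ⟨hP₁, h₁, hQ₁⟩ ⟨P₂, Q₂⟩ ⟨hP₂, h₂, hQ₂⟩ a b ha hb hab
  refine ⟨hP hP₁ hP₂ ha hb hab, ?_, hP hQ₁ hQ₂ ha hb hab⟩
  simp only at h₁ h₂
  simp [h₁, h₂, hab]

theorem convexOn_Jfun {n : ℕ} (N : ℕ) (c : Coef n) (m : Fin n → ℂ) :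
    ConvexOn ℝ (DomOp n N) (fun PQ : Coef n × Coef n => Jfun N c m PQ.1 PQ.2) := by
  refine ⟨convex_DomOp n N, ?_⟩
  rintro ⟨P₁, Q₁⟩ ⟨hP₁, -, hQ₁⟩ ⟨P₂, Q₂⟩ ⟨hP₂, -, hQ₂⟩ a b ha hb hab
  have hsum := Finset.sum_le_sum fun j hj =>
    mul_log_div_le (hP₁ j hj) (hQ₁ j hj) (hP₂ j hj) (hQ₂ j hj) ha hb hab
  rw [Finset.sum_add_distrib, ← Finset.mul_sum, ← Finset.mul_sum] at hsum
  have hN : (0 : ℝ) ≤ 1 / (2 * (N : ℝ)) := by positivity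
  have := mul_le_mul_of_nonneg_left hsum hN
  simp only [Jfun, Prod.smul_mk, Prod.mk_add_mk, evalR_add, evalR_smul, pairCP_add, pairCP_smul,
    smul_eq_mul]
  linarith

theorem deriv_deriv_Jfun {n N : ℕ} (c : Coef n) (m : Fin n → ℂ) {P Q : Coef n}
    (hP : P ∈ Pplus n N) (hQ : Q ∈ Pplus n N) (dP dQ : Coef n) :
    deriv (deriv (fun t : ℝ => Jfun N c m (P + t • dP) (Q + t • dQ))) 0 =
      (1 / (2 * (N : ℝ))) * ∑ j ∈ idxs N,
        (evalR dP (zet N j) -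
          evalR P (zet N j) / evalR Q (zet N j) * evalR dQ (zet N j)) ^ 2 /
          evalR P (zet N j) := by
  have hpos : ∀ {R : Coef n}, R ∈ Pplus n N → ∀ dR : Coef n,
      ∀ᶠ t : ℝ in 𝓝 0, ∀ j ∈ idxs N, 0 < evalR R (zet N j) + t * evalR dR (zet N j) := by
    intro R hR dR
    rw [Filter.eventually_all_finset]
    intro j hj
    have hc : ContinuousAt (fun t : ℝ => evalR R (zet N j) + t * evalR dR (zet N j)) 0 := by
      fun_prop
    exact hc.eventually (lt_mem_nhds (by simpa using hR j hj))
  have hfirst : deriv (fun t : ℝ => Jfun N c m (P + t • dP) (Q + t • dQ)) =ᶠ[𝓝 0] fun t =>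
      (pairCP c dQ - pairCP ((0 : ℝ), m) dP) + (1 / (2 * (N : ℝ))) * ∑ j ∈ idxs N,
        (evalR dP (zet N j) * Real.log ((evalR P (zet N j) + t * evalR dP (zet N j)) /
            (evalR Q (zet N j) + t * evalR dQ (zet N j))) + evalR dP (zet N j) -
          (evalR P (zet N j) + t * evalR dP (zet N j)) /
            (evalR Q (zet N j) + t * evalR dQ (zet N j)) * evalR dQ (zet N j)) := by
    filter_upwards [hpos hP dP, hpos hQ dQ] with t hPt hQt
    simp only [Jfun, evalR_add, evalR_smul, pairCP_add, pairCP_smul]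
    have hlin : ∀ u v : ℝ, HasDerivAt (fun s : ℝ => u + s * v) v t := fun u v => by
      simpa using ((hasDerivAt_id t).mul_const v).const_add u
    exact (((hlin _ _).sub (hlin _ _)).add ((HasDerivAt.fun_sum fun j hj =>
      hasDerivAt_mul_log_div (hPt j hj) (hQt j hj)).const_mul _)).deriv
  rw [hfirst.deriv_eq]
  exact (((HasDerivAt.fun_sum fun j hj =>
    hasDerivAt_log_div_sub_div (hP j hj) (hQ j hj)).const_mul _).const_add _).deriv

/-- `J` is convex on `𝔓°₊(N) × 𝔓₊(N)`; equivalently, its second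
directional derivative at any `(P,Q)` in any direction `(δP,δQ)` (with the constant
coefficient of `δP` zero) equals
`(1/(2N)) Σ_j (δP(ζ_j) − P(ζ_j)Q(ζ_j)⁻¹ δQ(ζ_j))² / P(ζ_j) ≥ 0`. -/
theorem J_convex_second_directional_derivative
    (n N : ℕ) (hn : 1 ≤ n) (hnN : n < N)
    (c : Coef n) (m : Fin n → ℂ) :
    ConvexOn ℝ (DomOp n N) (fun PQ : Coef n × Coef n => Jfun N c m PQ.1 PQ.2) ∧
    ∀ P Q : Coef n, (P, Q) ∈ DomOp n N → ∀ dP dQ : Coef n, dP.1 = 0 →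
      deriv (deriv (fun t : ℝ => Jfun N c m (P + t • dP) (Q + t • dQ))) 0 =
        (1 / (2 * (N : ℝ))) * ∑ j ∈ idxs N,
          (evalR dP (zet N j) -
            evalR P (zet N j) / evalR Q (zet N j) * evalR dQ (zet N j)) ^ 2 /
            evalR P (zet N j) ∧
      0 ≤ (1 / (2 * (N : ℝ))) * ∑ j ∈ idxs N,
          (evalR dP (zet N j) -
            evalR P (zet N j) / evalR Q (zet N j) * evalR dQ (zet N j)) ^ 2 /
            evalR P (zet N j) := by
  refine ⟨convexOn_Jfun N c m, ?_⟩
  rintro P Q ⟨hP, -, hQ⟩ dP dQ -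
  refine ⟨deriv_deriv_Jfun c m hP hQ dP dQ, ?_⟩
  exact mul_nonneg (by positivity) (Finset.sum_nonneg fun j hj =>
    div_nonneg (sq_nonneg _) (hP j hj).le)
end
end

section
/- Let P ∈ 𝔓_+(N). Then the moment map F^P is injective on 𝔓_+(N): if Q_1, Q_2 ∈ 𝔓_+(N) satisfy F^P(Q_1) = F^P(Q_2), then Q_1 = Q_2. -/
open Complex Finset Filter Topology

noncomputable section

lemma zet_eq_zpow (N : ℕ) (j : ℤ) : zet N j = zet N 1 ^ j := by
  unfold zet
  rw [← Complex.exp_int_mul]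
  congr 1
  push_cast
  ring

lemma zet_ne_zero (N : ℕ) (j : ℤ) : zet N j ≠ 0 := Complex.exp_ne_zero _

lemma conj_zet (N : ℕ) (j : ℤ) : (starRingEnd ℂ) (zet N j) = (zet N j)⁻¹ := by
  unfold zet
  rw [← Complex.exp_conj, ← Complex.exp_neg]
  congr 1
  simp
  ring

lemma isPrimitiveRoot_zet_one {N : ℕ} (hN : 0 < N) : IsPrimitiveRoot (zet N 1) (2 * N) := by
  have h := Complex.isPrimitiveRoot_exp (2 * N) (by omega)
  convert h using 1
  unfold zet
  congr 1
  push_cast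
  have : (N : ℂ) ≠ 0 := by exact_mod_cast hN.ne'
  field_simp

/-- The `m`-th powers of the `2N`-th roots of unity sum to zero unless `2N ∣ m`. -/
lemma sum_zet_zpow_eq_zero {N : ℕ} (hN : 0 < N) {m : ℤ} (hm : ¬ ((2 * N : ℕ) : ℤ) ∣ m) :
    ∑ j ∈ idxs N, zet N j ^ m = 0 := by
  have hprim := isPrimitiveRoot_zet_one hN
  set w := zet N 1 ^ m with hw
  have hw0 : w ≠ 0 := zpow_ne_zero _ (zet_ne_zero N 1)
  have hw1 : w ≠ 1 := fun h => hm ((hprim.zpow_eq_one_iff_dvd m).1 h)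
  have hwN : w ^ (2 * N) = 1 := by
    rw [hw, ← zpow_natCast, zpow_comm, zpow_natCast, hprim.pow_eq_one, one_zpow]
  have hterm : ∀ j, zet N j ^ m = w ^ j := fun j => by
    rw [zet_eq_zpow, hw, zpow_comm]
  have hreindex : ∑ j ∈ idxs N, w ^ j =
      ∑ i ∈ Finset.range (2 * N), w ^ (-(N : ℤ) + 1) * w ^ i := by
    symm
    refine Finset.sum_bij (fun i _ => -(N : ℤ) + 1 + i) ?_ ?_ ?_ ?_
    · intro i hi
      simp only [idxs, Finset.mem_Icc, Finset.mem_range] at *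
      omega
    · intro a _ b _ h
      simpa using h
    · intro j hj
      simp only [idxs, Finset.mem_Icc] at hj
      refine ⟨(j + N - 1).toNat, ?_, ?_⟩
      · simp only [Finset.mem_range]; omega
      · omega
    · intro i _
      rw [zpow_add₀ hw0 _ (i : ℤ), zpow_natCast]
  rw [Finset.sum_congr rfl fun j _ => hterm j, hreindex, ← Finset.mul_sum,
    geom_sum_eq hw1, hwN, sub_self, zero_div, mul_zero]

lemma evalR_zet {n : ℕ} (p : Coef n) (N : ℕ) (j : ℤ) :
    evalR p (zet N j) =
      p.1 + ∑ k : Fin n, 2 * ((starRingEnd ℂ) (p.2 k) * zet N j ^ ((k : ℤ) + 1)).re := by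
  unfold evalR evalC
  rw [Complex.add_re, Complex.ofReal_re, Complex.re_sum]
  congr 1
  refine Finset.sum_congr rfl fun k _ => ?_
  have h : p.2 k * (zet N j)⁻¹ ^ ((k : ℕ) + 1) =
      (starRingEnd ℂ) ((starRingEnd ℂ) (p.2 k) * zet N j ^ ((k : ℕ) + 1)) := by
    rw [map_mul, map_pow, conj_zet, Complex.conj_conj]
  rw [h, Complex.add_re, Complex.conj_re, ← two_mul]
  norm_cast

lemma ofReal_evalR_zet {n : ℕ} (p : Coef n) (N : ℕ) (j : ℤ) :
    (evalR p (zet N j) : ℂ) =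
      p.1 + ∑ k : Fin n, (p.2 k * zet N j ^ (-((k : ℤ) + 1)) +
        (starRingEnd ℂ) (p.2 k) * zet N j ^ ((k : ℤ) + 1)) := by
  rw [evalR_zet]
  push_cast
  congr 1
  refine Finset.sum_congr rfl fun k _ => ?_
  have h := Complex.add_conj ((starRingEnd ℂ) (p.2 k) * zet N j ^ ((k : ℤ) + 1))
  rw [map_mul, map_zpow₀, conj_zet, Complex.conj_conj, inv_zpow'] at h
  push_cast at h
  rw [← h, add_comm]

lemma evalR_sub {n : ℕ} (p q : Coef n) (z : ℂ) : evalR (p - q) z = evalR p z - evalR q z := by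
  unfold evalR evalC
  rw [← Complex.sub_re, add_sub_add_comm, ← Finset.sum_sub_distrib]
  congr 2
  · simp
  · refine Finset.sum_congr rfl fun k _ => ?_
    simp only [Prod.snd_sub, Pi.sub_apply, map_sub]
    ring

lemma sum_mul_evalR_eq_zero {n N : ℕ} {Ψ : ℤ → ℝ} (h0 : ∑ j ∈ idxs N, Ψ j = 0)
    (hk : ∀ k : Fin n, ∑ j ∈ idxs N, zet N j ^ ((k : ℤ) + 1) * (Ψ j : ℂ) = 0) (p : Coef n) :
    ∑ j ∈ idxs N, Ψ j * evalR p (zet N j) = 0 := by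
  simp only [evalR_zet, mul_add, Finset.sum_add_distrib, Finset.mul_sum]
  rw [← Finset.sum_mul, h0, zero_mul, zero_add, Finset.sum_comm]
  refine Finset.sum_eq_zero fun k _ => ?_
  have h := congrArg (fun w => 2 * ((starRingEnd ℂ) (p.2 k) * w).re) (hk k)
  simp only [mul_zero, Complex.zero_re, Finset.mul_sum, Complex.re_sum] at h
  rw [← h]
  refine Finset.sum_congr rfl fun j _ => ?_
  rw [← mul_assoc ((starRingEnd ℂ) (p.2 k)), Complex.re_mul_ofReal]
  ring

/-- A symmetric trigonometric polynomial of degree `n < N` vanishing at the `2N`-th roots of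
unity is zero. -/
lemma eq_zero_of_evalR_zet_eq_zero {n N : ℕ} (hnN : n < N) (p : Coef n)
    (h : ∀ j ∈ idxs N, evalR p (zet N j) = 0) : p = 0 := by
  have hN : 0 < N := by omega
  have hcard : ((idxs N).card : ℂ) ≠ 0 := by
    rw [Nat.cast_ne_zero, ← Nat.pos_iff_ne_zero, Finset.card_pos]
    exact ⟨N, by simp only [idxs, Finset.mem_Icc]; omega⟩
  have expand : ∀ m : ℤ, (p.1 : ℂ) * ∑ j ∈ idxs N, zet N j ^ m +
      ∑ k : Fin n, (p.2 k * ∑ j ∈ idxs N, zet N j ^ (m - ((k : ℤ) + 1)) +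
        (starRingEnd ℂ) (p.2 k) * ∑ j ∈ idxs N, zet N j ^ (m + ((k : ℤ) + 1))) = 0 := by
    intro m
    have hz : ∑ j ∈ idxs N, zet N j ^ m * (evalR p (zet N j) : ℂ) = 0 :=
      Finset.sum_eq_zero fun j hj => by rw [h j hj]; simp
    rw [← hz]
    simp only [Finset.mul_sum, ← Finset.sum_add_distrib]
    rw [Finset.sum_comm, ← Finset.sum_add_distrib]
    refine Finset.sum_congr rfl fun j _ => ?_
    rw [ofReal_evalR_zet, mul_add, Finset.mul_sum]
    congr 1
    · ring
    · refine Finset.sum_congr rfl fun k _ => ?_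
      rw [sub_eq_add_neg, zpow_add₀ (zet_ne_zero N j), zpow_add₀ (zet_ne_zero N j)]
      ring
  have hvan : ∀ m : ℤ, m ≠ 0 → |m| < 2 * N → ∑ j ∈ idxs N, zet N j ^ m = 0 :=
    fun m hm hlt => sum_zet_zpow_eq_zero hN fun hd =>
      hm (Int.eq_zero_of_abs_lt_dvd hd (by push_cast; exact hlt))
  refine Prod.ext ?_ (funext fun l => ?_)
  · have h0 := expand 0
    rw [Finset.sum_eq_zero (s := (Finset.univ : Finset (Fin n))), add_zero] at h0
    · simpa [hcard] using h0
    · intro k _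
      rw [hvan _ (by omega) (by rw [abs_lt]; omega), hvan _ (by omega) (by rw [abs_lt]; omega)]
      simp
  · have hl := expand ((l : ℤ) + 1)
    rw [hvan _ (by omega) (by rw [abs_lt]; omega), mul_zero, zero_add,
      Finset.sum_eq_single l] at hl
    · rw [hvan (_ + _) (by omega) (by rw [abs_lt]; omega)] at hl
      simpa [hcard] using hl
    · intro k _ hkl
      have hkl' : (k : ℕ) ≠ l := fun e => hkl (Fin.ext e)
      rw [hvan _ (by omega) (by rw [abs_lt]; omega), hvan _ (by omega) (by rw [abs_lt]; omega)]
      simp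
    · simp

/-- **Lemma 8.** For `P ∈ 𝔓₊(N)`, the moment map `F^P` is injective
on `𝔓₊(N)`. -/
theorem Fmap_injective
    (n N : ℕ) (hn : 1 ≤ n) (hnN : n < N) (P : Coef n) (hP : P ∈ Pplus n N) :
    ∀ Q₁ ∈ Pplus n N, ∀ Q₂ ∈ Pplus n N, Fmap N P Q₁ = Fmap N P Q₂ → Q₁ = Q₂ := by
  intro Q₁ hQ₁ Q₂ hQ₂ hF
  have hc : (1 / (2 * (N : ℂ))) ≠ 0 := by
    simpa using (by omega : N ≠ 0)
  set Ψ : ℤ → ℝ := fun j => phiOf N P Q₂ j - phiOf N P Q₁ j with hΨ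
  have h0 : ∑ j ∈ idxs N, Ψ j = 0 := by
    have h := congrArg Prod.fst hF
    have hre : ∀ Φ : ℤ → ℝ,
        (dmom N Φ 0).re = (1 / (2 * (N : ℝ))) * ∑ j ∈ idxs N, Φ j := by
      intro Φ
      rw [← Complex.ofReal_re ((1 / (2 * (N : ℝ))) * ∑ j ∈ idxs N, Φ j)]
      simp [dmom]
    simp only [Fmap, hre] at h
    have hc' : (1 / (2 * (N : ℝ))) ≠ 0 := by simpa using (by omega : N ≠ 0)
    rw [hΨ, Finset.sum_sub_distrib, mul_left_cancel₀ hc' h, sub_self]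
  have hk : ∀ k : Fin n, ∑ j ∈ idxs N, zet N j ^ ((k : ℤ) + 1) * (Ψ j : ℂ) = 0 := by
    intro k
    have h := mul_left_cancel₀ hc (congrFun (congrArg Prod.snd hF) k)
    simp only [hΨ, Complex.ofReal_sub, mul_sub, Finset.sum_sub_distrib]
    rw [h, sub_self]
  have hsum := sum_mul_evalR_eq_zero h0 hk (Q₁ - Q₂)
  have hterm : ∀ j ∈ idxs N, Ψ j * evalR (Q₁ - Q₂) (zet N j) =
      evalR P (zet N j) / (evalR Q₁ (zet N j) * evalR Q₂ (zet N j)) *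
        evalR (Q₁ - Q₂) (zet N j) ^ 2 := by
    intro j hj
    have h₁ := (hQ₁ j hj).ne'
    have h₂ := (hQ₂ j hj).ne'
    simp only [hΨ, phiOf, evalR_sub]
    field_simp
  have hpos : ∀ j ∈ idxs N,
      0 < evalR P (zet N j) / (evalR Q₁ (zet N j) * evalR Q₂ (zet N j)) :=
    fun j hj => div_pos (hP j hj) (mul_pos (hQ₁ j hj) (hQ₂ j hj))
  rw [Finset.sum_congr rfl hterm,
    Finset.sum_eq_zero_iff_of_nonneg fun j hj => mul_nonneg (hpos j hj).le (sq_nonneg _)] at hsum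
  refine sub_eq_zero.1 (eq_zero_of_evalR_zet_eq_zero hnN _ fun j hj => ?_)
  simpa [(hpos j hj).ne'] using hsum j hj
end
end
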